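/- Let n ≥ 1 and let U ⊆ ℂ be open. Suppose φ : ℂ → ℂ is infinitely differentiable on U and satisfies φ''(z) + (z/2) φ(z) = 0 for all z ∈ U. For m ≥ 1 let τ_m(z) = det[φ^{(j+k)}(z)]_{j,k=0}^{m−1} (the m×m determinant whose (j,k) entry is the (j+k)-th derivative of φ), and set τ_0(z) = 1. Suppose τ_n(z) ≠ 0 on U. Then σ_n(z) = τ_n'(z)/τ_n(z) satisfies the Jimbo–Miwa–Okamoto equation S_II(n − 1/2): (σ_n''(z))² + 4 (σ_n'(z))³ + 2 σ_n'(z) (z σ_n'(z) − σ_n(z)) = n²/4 for all z ∈ U. -/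

import Mathlib

open Matrix

/-- The derivative of a determinant is the sum over the columns of the determinants in which
that column is differentiated. -/
lemma hasDerivAt_det {ι : Type*} [Fintype ι] [DecidableEq ι] {A : ℂ → Matrix ι ι ℂ}
    {A' : Matrix ι ι ℂ} {z : ℂ} (h : ∀ i j, HasDerivAt (fun w => A w i j) (A' i j) z) :
    HasDerivAt (fun w => (A w).det) (∑ j, ((A z).updateCol j fun i => A' i j).det) z := by
  simp only [det_apply]
  rw [Finset.sum_comm]
  refine HasDerivAt.fun_sum fun s _ => ?_
  rw [← Finset.smul_sum]
  refine HasDerivAt.const_smul _ ?_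
  refine (HasDerivAt.fun_finsetProd (u := Finset.univ) (fun j _ => h (s j) j)).congr_deriv ?_
  refine Finset.sum_congr rfl fun j _ => ?_
  rw [← Finset.prod_erase_mul _ _ (Finset.mem_univ j), smul_eq_mul]
  congr 1
  · refine Finset.prod_congr rfl fun k hk => ?_
    rw [updateCol_ne (Finset.ne_of_mem_erase hk)]
  · rw [updateCol_self]

/-- The Desnanot–Jacobi identity for the two last rows and columns of a block matrix, when the
top left block is nonsingular. -/
lemma det_mul_det_fromBlocks_fin_two {K ι : Type*} [Field K] [Fintype ι] [DecidableEq ι]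
    {A : Matrix ι ι K} (hA : A.det ≠ 0) (B : Matrix ι (Fin 2) K) (C : Matrix (Fin 2) ι K)
    (D : Matrix (Fin 2) (Fin 2) K) (d : Fin 2 → Fin 2 → K)
    (hd : ∀ a b, d a b = (fromBlocks A (B.submatrix id fun _ : Fin 1 => b)
      (C.submatrix (fun _ : Fin 1 => a) id) (D.submatrix (fun _ => a) fun _ => b)).det) :
    A.det * (fromBlocks A B C D).det = d 0 0 * d 1 1 - d 0 1 * d 1 0 := by
  let _ : Invertible A := invertibleOfIsUnitDet A (Ne.isUnit hA)
  have key : ∀ a b, d a b = A.det * (D - C * ⅟A * B) a b := by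
    intro a b
    rw [hd, det_fromBlocks₁₁, det_fin_one]
    rfl
  rw [key, key, key, key, det_fromBlocks₁₁, det_fin_two]
  ring

/-- The determinant `det [φ^{(r_i + c_j)}(z)]`. -/
noncomputable def hankelDet {ι : Type*} [Fintype ι] [DecidableEq ι] (φ : ℂ → ℂ) (r c : ι → ℕ)
    (z : ℂ) : ℂ :=
  (of fun i j => iteratedDeriv (r i + c j) φ z).det

lemma hankelDet_comm {ι : Type*} [Fintype ι] [DecidableEq ι] (φ : ℂ → ℂ) (r c : ι → ℕ) :
    hankelDet φ r c = hankelDet φ c r := by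
  ext z
  rw [hankelDet, ← det_transpose, hankelDet]
  congr 1
  ext i j
  simp [add_comm]

lemma hankelDet_comp_equiv {ι κ : Type*} [Fintype ι] [DecidableEq ι] [Fintype κ] [DecidableEq κ]
    (φ : ℂ → ℂ) (r c : ι → ℕ) (e : κ ≃ ι) :
    hankelDet φ (r ∘ e) (c ∘ e) = hankelDet φ r c := by
  ext z
  exact det_submatrix_equiv_self e (of fun i j => iteratedDeriv (r i + c j) φ z)

lemma hasDerivAt_hankelDet {ι : Type*} [Fintype ι] [DecidableEq ι] {φ : ℂ → ℂ} {z : ℂ}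
    (hφ : AnalyticAt ℂ φ z) (r c : ι → ℕ) :
    HasDerivAt (hankelDet φ r c)
      (∑ j, hankelDet φ r (Function.update c j (c j + 1)) z) z := by
  have h := hasDerivAt_det (A := fun w => of fun i j => iteratedDeriv (r i + c j) φ w)
    (A' := of fun i j => iteratedDeriv (r i + c j + 1) φ z) (z := z) (fun i j => by
      have := (hφ.iterated_deriv (r i + c j)).differentiableAt.hasDerivAt
      simpa only [of_apply, iteratedDeriv_succ, iteratedDeriv_eq_iterate] using this)
  refine h.congr_deriv ?_
  refine Finset.sum_congr rfl fun j _ => ?_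
  rw [hankelDet]
  congr 1
  ext i k
  by_cases hk : k = j
  · subst hk
    simp [add_assoc]
  · simp [hk]

/-- The indices `0, …, m - 1` followed by the indices `s`. -/
def bordered {κ : Type*} (m : ℕ) (s : κ → ℕ) : Fin m ⊕ κ → ℕ :=
  Sum.elim (fun i => (i : ℕ)) s

lemma hankelDet_bordered_eq (φ : ℂ → ℂ) (m k : ℕ) :
    hankelDet φ (bordered m fun i : Fin k => m + i) (bordered m fun i : Fin k => m + i) =
      hankelDet φ (fun i : Fin (m + k) => (i : ℕ)) (fun i => (i : ℕ)) := by
  rw [← hankelDet_comp_equiv φ _ _ finSumFinEquiv]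
  congr 1 <;> (ext i; cases i <;> simp [bordered])

/-- Differentiating along the columns `0, …, m - 1, m` only moves the last one. -/
lemma hasDerivAt_hankelDet_bordered {φ : ℂ → ℂ} {z : ℂ} (hφ : AnalyticAt ℂ φ z) (m : ℕ)
    (r : Fin m ⊕ Fin 1 → ℕ) :
    HasDerivAt (hankelDet φ r (bordered m fun _ => m))
      (hankelDet φ r (bordered m fun _ => m + 1) z) z := by
  refine (hasDerivAt_hankelDet hφ r (bordered m fun _ => m)).congr_deriv ?_
  rw [Fintype.sum_sum_type, Finset.sum_eq_zero, zero_add, Fin.sum_univ_one]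
  · congr 1
    ext i
    cases i with
    | inl i => simp [bordered]
    | inr i => simp [bordered, Subsingleton.elim i 0]
  · intro i _
    by_cases hi : (i : ℕ) + 1 < m
    · have hne : (Sum.inl ⟨i + 1, hi⟩ : Fin m ⊕ Fin 1) ≠ Sum.inl i :=
        fun h => by simpa using congrArg Fin.val (Sum.inl_injective h)
      refine det_zero_of_column_eq hne.symm fun k => ?_
      rw [of_apply, of_apply, Function.update_self, Function.update_of_ne hne]
      rfl
    · have hm : (i : ℕ) + 1 = m := by omega
      refine det_zero_of_column_eq (i := Sum.inl i) (j := Sum.inr 0) (by simp) fun k => ?_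
      rw [of_apply, of_apply, Function.update_self, Function.update_of_ne (by simp)]
      simp only [bordered, Sum.elim_inl, Sum.elim_inr, hm]

/-- The Hankel determinant `det [φ^{(j+k)}]`, `0 ≤ j, k < m`. -/
noncomputable def hankelTau (φ : ℂ → ℂ) (m : ℕ) : ℂ → ℂ :=
  hankelDet φ (fun i : Fin m => (i : ℕ)) fun i => (i : ℕ)

lemma hankelTau_succ (φ : ℂ → ℂ) (m : ℕ) :
    hankelTau φ (m + 1) = hankelDet φ (bordered m fun _ : Fin 1 => m) (bordered m fun _ => m) := by
  rw [hankelTau, ← hankelDet_bordered_eq]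
  simp

lemma analyticOnNhd_hankelTau {φ : ℂ → ℂ} {U : Set ℂ} (hU : IsOpen U)
    (hφ : AnalyticOnNhd ℂ φ U) (m : ℕ) : AnalyticOnNhd ℂ (hankelTau φ m) U :=
  DifferentiableOn.analyticOnNhd (fun z hz =>
    (hasDerivAt_hankelDet (hφ z hz) _ _).differentiableAt.differentiableWithinAt) hU

lemma hankelTau_mul_hankelTau {φ : ℂ → ℂ} {U : Set ℂ} (hU : IsOpen U)
    (hφ : AnalyticOnNhd ℂ φ U) (m : ℕ) {z : ℂ} (hz : z ∈ U) (h0 : hankelTau φ m z ≠ 0) :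
    hankelTau φ m z * hankelTau φ (m + 2) z =
      hankelTau φ (m + 1) z * deriv (deriv (hankelTau φ (m + 1))) z -
        deriv (hankelTau φ (m + 1)) z ^ 2 := by
  have h1 : ∀ w ∈ U, deriv (hankelTau φ (m + 1)) w =
      hankelDet φ (bordered m fun _ : Fin 1 => m + 1) (bordered m fun _ => m) w := by
    intro w hw
    rw [hankelTau_succ, hankelDet_comm φ (bordered m fun _ => m + 1)]
    exact (hasDerivAt_hankelDet_bordered (hφ w hw) m _).deriv
  have h2 : deriv (deriv (hankelTau φ (m + 1))) z =
      hankelDet φ (bordered m fun _ : Fin 1 => m + 1) (bordered m fun _ => m + 1) z := by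
    rw [(Filter.eventuallyEq_of_mem (hU.mem_nhds hz) h1).deriv_eq]
    exact (hasDerivAt_hankelDet_bordered (hφ z hz) m _).deriv
  have h3 := det_mul_det_fromBlocks_fin_two h0
    (of fun i b => iteratedDeriv (i + (m + b)) φ z)
    (of fun a j => iteratedDeriv (m + a + j) φ z)
    (of fun a b => iteratedDeriv (m + a + (m + b)) φ z)
    (fun a b => hankelDet φ (bordered m fun _ : Fin 1 => m + a) (bordered m fun _ => m + b) z)
    (fun a b => by
      rw [hankelDet]
      congr 1
      ext i j
      cases i <;> cases j <;> simp [bordered])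
  have h4 : hankelTau φ (m + 2) z = (fromBlocks
      (of fun i j : Fin m => iteratedDeriv ((i : ℕ) + (j : ℕ)) φ z)
      (of fun (i : Fin m) (b : Fin 2) => iteratedDeriv (i + (m + b)) φ z)
      (of fun (a : Fin 2) (j : Fin m) => iteratedDeriv (m + a + j) φ z)
      (of fun a b : Fin 2 => iteratedDeriv (m + a + (m + b)) φ z)).det := by
    rw [hankelTau, ← hankelDet_bordered_eq, hankelDet]
    congr 1
    ext i j
    cases i <;> cases j <;> simp [bordered]
  rw [h4, h1 z hz, h2, hankelTau_succ]
  refine h3.trans ?_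
  rw [hankelDet_comm φ (bordered m fun _ => m + ((1 : Fin 2) : ℕ))
    (bordered m fun _ => m + ((0 : Fin 2) : ℕ))]
  simp only [Fin.val_zero, Fin.val_one, add_zero]
  rw [hankelDet_comm φ (bordered m fun _ => m + 1) (bordered m fun _ => m)]
  ring

lemma hankelTau_zero (φ : ℂ → ℂ) : hankelTau φ 0 = 1 := by
  ext z
  exact det_isEmpty

lemma hankelTau_one (φ : ℂ → ℂ) : hankelTau φ 1 = φ := by
  ext z
  simp [hankelTau, hankelDet]

lemma analyticAt_logDeriv {f : ℂ → ℂ} {z : ℂ} (hf : AnalyticAt ℂ f z) (h0 : f z ≠ 0) :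
    AnalyticAt ℂ (logDeriv f) z :=
  hf.deriv.div hf h0

/-- The Toda equation. -/
lemma deriv_logDeriv_hankelTau {φ : ℂ → ℂ} {U : Set ℂ} (hU : IsOpen U)
    (hφ : AnalyticOnNhd ℂ φ U) (m : ℕ) {z : ℂ} (hz : z ∈ U) (h0 : hankelTau φ m z ≠ 0)
    (h1 : hankelTau φ (m + 1) z ≠ 0) :
    deriv (logDeriv (hankelTau φ (m + 1))) z =
      hankelTau φ m z * hankelTau φ (m + 2) z / hankelTau φ (m + 1) z ^ 2 := by
  have hT := analyticOnNhd_hankelTau hU hφ (m + 1) z hz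
  rw [logDeriv, deriv_div hT.deriv.differentiableAt hT.differentiableAt h1,
    hankelTau_mul_hankelTau hU hφ m hz h0]
  ring

/-- The Bäcklund relations between `σ_m` and `σ_{m+1}` at a point where `τ_m` and `τ_{m+1}` do
not vanish. -/
structure AiryBacklundAt (φ : ℂ → ℂ) (m : ℕ) (z : ℂ) : Prop where
  left_ne_zero : hankelTau φ m z ≠ 0
  right_ne_zero : hankelTau φ (m + 1) z ≠ 0
  deriv_add_deriv : deriv (logDeriv (hankelTau φ (m + 1))) z +
    deriv (logDeriv (hankelTau φ m)) z + z / 2 +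
      (logDeriv (hankelTau φ (m + 1)) z - logDeriv (hankelTau φ m) z) ^ 2 = 0
  deriv_deriv : deriv (deriv (logDeriv (hankelTau φ m))) z =
    2 * deriv (logDeriv (hankelTau φ m)) z *
      (logDeriv (hankelTau φ (m + 1)) z - logDeriv (hankelTau φ m) z) + m / 2
  quadratic : 2 * deriv (logDeriv (hankelTau φ m)) z *
      (logDeriv (hankelTau φ (m + 1)) z - logDeriv (hankelTau φ m) z) ^ 2 +
    m * (logDeriv (hankelTau φ (m + 1)) z - logDeriv (hankelTau φ m) z) +
      2 * deriv (logDeriv (hankelTau φ m)) z ^ 2 +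
        z * deriv (logDeriv (hankelTau φ m)) z - logDeriv (hankelTau φ m) z = 0

lemma AiryBacklundAt.deriv_deriv_succ {φ : ℂ → ℂ} {U V : Set ℂ} (hU : IsOpen U)
    (hφ : AnalyticOnNhd ℂ φ U) (hV : IsOpen V) (hVU : V ⊆ U) {m : ℕ}
    (h : ∀ z ∈ V, AiryBacklundAt φ m z) {z : ℂ} (hz : z ∈ V) :
    deriv (deriv (logDeriv (hankelTau φ (m + 1)))) z =
      -2 * (logDeriv (hankelTau φ (m + 1)) z - logDeriv (hankelTau φ m) z) *
        deriv (logDeriv (hankelTau φ (m + 1))) z - (m + 1) / 2 := by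
  have ha := analyticAt_logDeriv (analyticOnNhd_hankelTau hU hφ m z (hVU hz))
    (h z hz).left_ne_zero
  have hb := analyticAt_logDeriv (analyticOnNhd_hankelTau hU hφ (m + 1) z (hVU hz))
    (h z hz).right_ne_zero
  have hd := ((ha.deriv.differentiableAt.hasDerivAt.neg.sub
    ((hasDerivAt_id z).div_const 2)).sub ((hb.differentiableAt.hasDerivAt.sub
      ha.differentiableAt.hasDerivAt).pow 2))
  have he : deriv (logDeriv (hankelTau φ (m + 1))) =ᶠ[nhds z] _ :=
    Filter.eventuallyEq_of_mem (hV.mem_nhds hz) fun w hw => by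
      have := (h w hw).deriv_add_deriv
      exact (by linear_combination this :
        deriv (logDeriv (hankelTau φ (m + 1))) w =
          -deriv (logDeriv (hankelTau φ m)) w - w / 2 -
            (logDeriv (hankelTau φ (m + 1)) w - logDeriv (hankelTau φ m) w) ^ 2)
  rw [(hd.congr_of_eventuallyEq he).deriv]
  simp only [Pi.sub_apply]
  linear_combination -(h z hz).deriv_deriv 

lemma AiryBacklundAt.succ {φ : ℂ → ℂ} {U V : Set ℂ} (hU : IsOpen U)
    (hφ : AnalyticOnNhd ℂ φ U) (hV : IsOpen V) (hVU : V ⊆ U) {m : ℕ}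
    (h : ∀ z ∈ V, AiryBacklundAt φ m z)
    (h0 : ∀ z ∈ V, deriv (logDeriv (hankelTau φ (m + 1))) z ≠ 0) {z : ℂ} (hz : z ∈ V) :
    AiryBacklundAt φ (m + 1) z := by
  have hT : ∀ k, ∀ w ∈ V, AnalyticAt ℂ (hankelTau φ k) w :=
    fun k w hw => analyticOnNhd_hankelTau hU hφ k w (hVU hw)
  have htoda : ∀ w ∈ V, deriv (logDeriv (hankelTau φ (m + 1))) w =
      hankelTau φ m w * hankelTau φ (m + 2) w / hankelTau φ (m + 1) w ^ 2 := fun w hw =>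
    deriv_logDeriv_hankelTau hU hφ m (hVU hw) (h w hw).left_ne_zero (h w hw).right_ne_zero
  have hne : ∀ w ∈ V, hankelTau φ (m + 2) w ≠ 0 := fun w hw h2 =>
    h0 w hw (by rw [htoda w hw, h2]; simp)
  have hp : ∀ w ∈ V, deriv (deriv (logDeriv (hankelTau φ (m + 1)))) w =
      deriv (logDeriv (hankelTau φ (m + 1))) w * (logDeriv (hankelTau φ (m + 2)) w +
        logDeriv (hankelTau φ m) w - 2 * logDeriv (hankelTau φ (m + 1)) w) := by
    intro w hw
    have d0 := (hT m w hw).differentiableAt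
    have d1 := (hT (m + 1) w hw).differentiableAt
    have d2 := (hT (m + 2) w hw).differentiableAt
    have n0 := (h w hw).left_ne_zero
    have n1 := (h w hw).right_ne_zero
    rw [htoda w hw]
    refine ((Filter.eventuallyEq_of_mem (hV.mem_nhds hw) htoda).deriv_eq.trans
      ((d0.hasDerivAt.mul d2.hasDerivAt).div (d1.hasDerivAt.pow 2)
        (pow_ne_zero 2 n1)).deriv).trans ?_
    have n2 := hne w hw
    simp only [logDeriv_apply, Pi.mul_apply, Pi.pow_apply]
    field_simp
    ring
  have hs : ∀ w ∈ V, logDeriv (hankelTau φ (m + 2)) w - logDeriv (hankelTau φ (m + 1)) w =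
      -(logDeriv (hankelTau φ (m + 1)) w - logDeriv (hankelTau φ m) w) -
        ((m : ℂ) + 1) / 2 / deriv (logDeriv (hankelTau φ (m + 1))) w := by
    intro w hw
    have e1 := hp w hw
    rw [AiryBacklundAt.deriv_deriv_succ hU hφ hV hVU h hw] at e1
    have := h0 w hw
    field_simp
    linear_combination -2 * e1
  have ha := analyticAt_logDeriv (hT m z hz) (h z hz).left_ne_zero
  have hb := analyticAt_logDeriv (hT (m + 1) z hz) (h z hz).right_ne_zero
  have hc := analyticAt_logDeriv (hT (m + 2) z hz) (hne z hz)
  have hds : deriv (logDeriv (hankelTau φ (m + 2))) z -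
      deriv (logDeriv (hankelTau φ (m + 1))) z =
      -(deriv (logDeriv (hankelTau φ (m + 1))) z - deriv (logDeriv (hankelTau φ m)) z) -
        -(((m : ℂ) + 1) / 2 * deriv (deriv (logDeriv (hankelTau φ (m + 1)))) z) /
          deriv (logDeriv (hankelTau φ (m + 1))) z ^ 2 := by
    have hl := hc.differentiableAt.hasDerivAt.sub hb.differentiableAt.hasDerivAt
    have hr := (hb.differentiableAt.hasDerivAt.sub ha.differentiableAt.hasDerivAt).neg.sub
      ((hasDerivAt_const z (((m : ℂ) + 1) / 2)).div hb.deriv.differentiableAt.hasDerivAt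
        (h0 z hz))
    have he := hl.unique (hr.congr_of_eventuallyEq
      (Filter.eventuallyEq_of_mem (hV.mem_nhds hz) hs))
    simpa using he
  have hpz := hp z hz
  have hsz := hs z hz
  obtain ⟨-, n1, h1, -, h3⟩ := h z hz
  have hpne := h0 z hz
  have hk : ((m : ℂ) + 1) / 2 = (logDeriv (hankelTau φ m) z -
      logDeriv (hankelTau φ (m + 2)) z) * deriv (logDeriv (hankelTau φ (m + 1))) z := by
    field_simp at hsz
    linear_combination hsz / 2
  rw [hk, hpz] at hds
  field_simp at hds
  refine ⟨n1, hne z hz, ?_, ?_, ?_⟩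
  · linear_combination hds + h1
  · push_cast
    linear_combination hpz - hk
  · push_cast
    linear_combination 2 * (logDeriv (hankelTau φ (m + 2)) z + logDeriv (hankelTau φ m) z -
      2 * logDeriv (hankelTau φ (m + 1)) z) * hk + 2 * (deriv (logDeriv (hankelTau φ (m + 1))) z -
        deriv (logDeriv (hankelTau φ m)) z) * h1 + h3

/-- A solution of the Airy-type equation that does not vanish identically on an open set `V`
satisfies the Bäcklund relations of any given order on some nonempty open subset of `V`. -/
lemma exists_airyBacklundAt {φ : ℂ → ℂ} {U : Set ℂ} (hU : IsOpen U) (hφ : AnalyticOnNhd ℂ φ U)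
    (hairy : ∀ z ∈ U, deriv (deriv φ) z + z / 2 * φ z = 0) {V : Set ℂ} (hV : IsOpen V)
    (hVU : V ⊆ U) (h0 : ∃ z ∈ V, φ z ≠ 0) (m : ℕ) :
    ∃ W ⊆ V, IsOpen W ∧ W.Nonempty ∧ ∀ z ∈ W, AiryBacklundAt φ m z := by
  have shrink : ∀ {f : ℂ → ℂ} {W : Set ℂ}, IsOpen W → AnalyticOnNhd ℂ f W →
      IsOpen {z | z ∈ W ∧ f z ≠ 0} := fun hW hf =>
    hf.continuousOn.isOpen_inter_preimage hW isOpen_ne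
  induction m with
  | zero =>
    obtain ⟨z₀, hz₀, hne⟩ := h0
    refine ⟨{z | z ∈ V ∧ φ z ≠ 0}, fun z hz => hz.1, shrink hV (hφ.mono hVU), ⟨z₀, hz₀, hne⟩,
      fun z ⟨hz, hz0⟩ => ?_⟩
    have ha := hφ z (hVU hz)
    have h1 : logDeriv (hankelTau φ 0) = 0 := by
      rw [hankelTau_zero]
      exact logDeriv_const 1
    have h2 : deriv (logDeriv φ) z = -z / 2 - logDeriv φ z ^ 2 := by
      rw [logDeriv, deriv_div ha.deriv.differentiableAt ha.differentiableAt hz0,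
        eq_neg_of_add_eq_zero_left (hairy z (hVU hz)), Pi.div_apply]
      field_simp
    have h3 : deriv (0 : ℂ → ℂ) = 0 := deriv_const' 0
    refine ⟨by simp [hankelTau_zero], by simpa [hankelTau_one] using hz0, ?_, ?_, ?_⟩
    · simp only [h1, h3, zero_add, hankelTau_one, h2, Pi.zero_apply]
      ring
    · simp [h1, h3]
    · simp [h1, h3]
  | succ m ih =>
    obtain ⟨W, hWV, hW, hWne, h⟩ := ih
    have hWU := hWV.trans hVU
    have hex : ∃ z ∈ W, deriv (logDeriv (hankelTau φ (m + 1))) z ≠ 0 := by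
      by_contra! hcon
      obtain ⟨z, hz⟩ := hWne
      have e := AiryBacklundAt.deriv_deriv_succ hU hφ hW hWU h hz
      have e0 : deriv (deriv (logDeriv (hankelTau φ (m + 1)))) z = 0 := by
        have := (Filter.eventuallyEq_of_mem (hW.mem_nhds hz) hcon).deriv_eq
        simpa using this
      rw [e0, hcon z hz] at e
      exact Nat.cast_add_one_ne_zero (R := ℂ) m (by linear_combination 2 * e)
    obtain ⟨z₀, hz₀, hne⟩ := hex
    have hopen : IsOpen {z | z ∈ W ∧ deriv (logDeriv (hankelTau φ (m + 1))) z ≠ 0} :=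
      shrink hW fun z hz => (analyticAt_logDeriv
        (analyticOnNhd_hankelTau hU hφ (m + 1) z (hWU hz)) (h z hz).right_ne_zero).deriv
    exact ⟨_, fun z hz => hWV hz.1, hopen, ⟨z₀, hz₀, hne⟩, fun z hz =>
      AiryBacklundAt.succ hU hφ hopen (fun z hz => hWU hz.1) (fun z hz => h z hz.1)
        (fun z hz => hz.2) hz⟩

/-- If `φ` vanishes on an open set then so do the Hankel determinants of positive size. -/
lemma hankelTau_eq_zero {φ : ℂ → ℂ} {V : Set ℂ} (hV : IsOpen V) (h : ∀ z ∈ V, φ z = 0) (m : ℕ)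
    {z : ℂ} (hz : z ∈ V) : hankelTau φ (m + 1) z = 0 := by
  refine det_eq_zero_of_row_eq_zero 0 fun j => ?_
  have he : φ =ᶠ[nhds z] fun _ => 0 := Filter.eventuallyEq_of_mem (hV.mem_nhds hz) h
  rw [of_apply, he.iteratedDeriv_eq]
  simp


/-- Airy-type solutions of S_II: if `φ` solves `φ'' + zφ/2 = 0` on an open set `U`, and
`τ_m` is the `m × m` Hankel determinant of derivatives of `φ` (with `τ_0 = 1`), with
`τ_n` nonvanishing on `U`, then `σ_n = (log τ_n)' = τ_n'/τ_n` solves the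
Jimbo–Miwa–Okamoto equation S_II(n − 1/2) on `U`. -/
theorem airy_determinant_solutions_SII (n : ℕ) (hn : 1 ≤ n) (U : Set ℂ) (hU : IsOpen U)
    (φ : ℂ → ℂ)
    (hφ : ContDiffOn ℂ ⊤ φ U)
    (hairy : ∀ z ∈ U, deriv (deriv φ) z + z / 2 * φ z = 0)
    (τ : ℕ → ℂ → ℂ)
    (hτ0 : ∀ z, τ 0 z = 1)
    (hτ : ∀ m : ℕ, 1 ≤ m → ∀ z,
      τ m z = Matrix.det (Matrix.of fun j k : Fin m => iteratedDeriv ((j : ℕ) + (k : ℕ)) φ z))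
    (hτn0 : ∀ z ∈ U, τ n z ≠ 0)
    (σ : ℂ → ℂ)
    (hσdef : ∀ z, σ z = deriv (τ n) z / τ n z) :
    ∀ z ∈ U, DifferentiableAt ℂ σ z ∧ DifferentiableAt ℂ (deriv σ) z ∧
      (deriv (deriv σ) z) ^ 2 + 4 * (deriv σ z) ^ 3
        + 2 * deriv σ z * (z * deriv σ z - σ z) = (n : ℂ) ^ 2 / 4 := by
  obtain ⟨m, rfl⟩ : ∃ m, n = m + 1 := ⟨n - 1, by omega⟩
  have hφa : AnalyticOnNhd ℂ φ U := (hφ.differentiableOn (by simp)).analyticOnNhd hU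
  have hτm : τ (m + 1) = hankelTau φ (m + 1) := funext (hτ (m + 1) hn)
  rw [hτm] at hτn0 hσdef
  obtain rfl : σ = logDeriv (hankelTau φ (m + 1)) := funext hσdef
  have ha : AnalyticOnNhd ℂ (logDeriv (hankelTau φ (m + 1))) U := fun z hz =>
    analyticAt_logDeriv (analyticOnNhd_hankelTau hU hφa (m + 1) z hz) (hτn0 z hz)
  refine fun z hz => ⟨(ha z hz).differentiableAt, (ha z hz).deriv.differentiableAt, ?_⟩
  by_contra hcon
  set F : ℂ → ℂ := fun w => deriv (deriv (logDeriv (hankelTau φ (m + 1)))) w ^ 2 +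
    4 * deriv (logDeriv (hankelTau φ (m + 1))) w ^ 3 +
      2 * deriv (logDeriv (hankelTau φ (m + 1))) w *
        (w * deriv (logDeriv (hankelTau φ (m + 1))) w - logDeriv (hankelTau φ (m + 1)) w) with hF
  have hFc : ContinuousOn F U := by
    have c0 := ha.continuousOn
    have c1 := ha.deriv.continuousOn
    have c2 := ha.deriv.deriv.continuousOn
    fun_prop
  have hV : IsOpen {w | w ∈ U ∧ F w ≠ ((m + 1 : ℕ) : ℂ) ^ 2 / 4} :=
    hFc.isOpen_inter_preimage hU isOpen_ne
  have hφ0 : ∃ w ∈ {w | w ∈ U ∧ F w ≠ ((m + 1 : ℕ) : ℂ) ^ 2 / 4}, φ w ≠ 0 := by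
    by_contra! h
    exact hτn0 z hz (hankelTau_eq_zero hV h m ⟨hz, hcon⟩)
  obtain ⟨W, hWV, hW, ⟨w, hw⟩, h⟩ :=
    exists_airyBacklundAt hU hφa hairy hV (fun w hw => hw.1) hφ0 m
  refine (hWV hw).2 ?_
  have hp := AiryBacklundAt.deriv_deriv_succ hU hφa hW (fun w hw => (hWV hw).1) h hw
  obtain ⟨-, -, h1, -, h3⟩ := h w hw
  simp only [hF, hp]
  push_cast
  linear_combination 2 * deriv (logDeriv (hankelTau φ (m + 1))) w *
    (2 * (deriv (logDeriv (hankelTau φ (m + 1))) w - deriv (logDeriv (hankelTau φ m)) w) * h1 + h3)
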